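/- For all integers ℓ ≥ 2, r ≥ 2, k ≥ 1 and m > r, D_r(m,k;ℓ) ≥ D_r^smp(⌈m/(k+1)⌉, k; ℓ). -/

import Mathlib

/-- The coloring `φ` of the `(k+r)`-element subsets of `[n]` admits a monochromatic
`(r,m,k)`-daisy: disjoint sets `K, M ⊆ [n]` with `|K| = k`, `|M| = m` such that `φ`
is constant on `{K ∪ P : P ⊆ M, |P| = r}`. -/
def HasMonoDaisyK (n r m k ℓ : ℕ) (φ : Finset ℕ → Fin ℓ) : Prop :=
  ∃ K M : Finset ℕ, K ⊆ Finset.range n ∧ M ⊆ Finset.range n ∧ Disjoint K M ∧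
    K.card = k ∧ M.card = m ∧ ∃ c : Fin ℓ, ∀ P ⊆ M, P.card = r → φ (K ∪ P) = c

/-- `D_r(m,k;ℓ)`: the least `n` such that every `ℓ`-coloring of the `(k+r)`-element
subsets of `[n]` admits a monochromatic `(r,m,k)`-daisy. -/
noncomputable def daisyRamseyK (r m k ℓ : ℕ) : ℕ :=
  sInf {n | ∀ φ : Finset ℕ → Fin ℓ, HasMonoDaisyK n r m k ℓ φ}

/-- As `HasMonoDaisyK`, additionally requiring the daisy to be *simple*: every element
of the kernel `K` is either below all of `M` or above all of `M`. -/
def HasMonoSimpleDaisyK (n r m k ℓ : ℕ) (φ : Finset ℕ → Fin ℓ) : Prop :=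
  ∃ K M : Finset ℕ, K ⊆ Finset.range n ∧ M ⊆ Finset.range n ∧ Disjoint K M ∧
    K.card = k ∧ M.card = m ∧ (∀ x ∈ K, (∀ y ∈ M, x < y) ∨ (∀ y ∈ M, y < x)) ∧
    ∃ c : Fin ℓ, ∀ P ⊆ M, P.card = r → φ (K ∪ P) = c

/-- `D_r^smp(m,k;ℓ)`: the least `n` such that every `ℓ`-coloring of the `(k+r)`-element
subsets of `[n]` admits a monochromatic simple `(r,m,k)`-daisy. -/
noncomputable def simpleDaisyRamseyK (r m k ℓ : ℕ) : ℕ :=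
  sInf {n | ∀ φ : Finset ℕ → Fin ℓ, HasMonoSimpleDaisyK n r m k ℓ φ}

theorem ramsey_aux (ℓ : ℕ) (hℓ : 0 < ℓ) (r : ℕ) : ∀ m : ℕ, ∃ N : ℕ, ∀ S : Finset ℕ, N ≤ S.card →
    ∀ φ : Finset ℕ → Fin ℓ, ∃ M ⊆ S, M.card = m ∧ ∃ c, ∀ P ⊆ M, P.card = r → φ P = c := by
  induction r with
  | zero =>
    intro m
    refine ⟨m, fun S hS φ => ?_⟩
    obtain ⟨M, hM, hc⟩ := Finset.exists_subset_card_eq hS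
    refine ⟨M, hM, hc, φ ∅, fun P _ hP => ?_⟩
    rw [Finset.card_eq_zero.mp hP]
  | succ r ih =>
    have claim : ∀ t : ℕ, ∃ N : ℕ, ∀ S : Finset ℕ, N ≤ S.card → ∀ φ : Finset ℕ → Fin ℓ,
        ∃ T ⊆ S, T.card = t ∧ ∃ χ : ℕ → Fin ℓ, ∀ x ∈ T, ∀ P ⊆ T, (∀ y ∈ P, x < y) →
          P.card = r → φ (insert x P) = χ x := by
      intro t
      induction t with
      | zero =>
        refine ⟨0, fun S _ φ => ⟨∅, by simp, by simp, fun _ => ⟨0, hℓ⟩, by simp⟩⟩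
      | succ t iht =>
        obtain ⟨N₁, h₁⟩ := iht
        obtain ⟨N₂, h₂⟩ := ih N₁
        refine ⟨N₂ + 1, fun S hS φ => ?_⟩
        have hne : S.Nonempty := Finset.card_pos.mp (by omega)
        obtain ⟨x, hx, hmin⟩ : ∃ x ∈ S, ∀ y ∈ S, x ≤ y :=
          ⟨S.min' hne, S.min'_mem hne, fun y hy => S.min'_le y hy⟩
        obtain ⟨S', hS', hc', c, hcol⟩ := h₂ (S.erase x)
          (by rw [Finset.card_erase_of_mem hx]; omega) (fun P => φ (insert x P))
        obtain ⟨T, hT, hTc, χ, hχ⟩ := h₁ S' hc'.ge φ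
        have hlt : ∀ y ∈ T, x < y := fun y hy => by
          have h := Finset.mem_erase.mp (hS' (hT hy))
          have := hmin y h.2
          have := h.1
          omega
        have hxT : x ∉ T := fun h => lt_irrefl _ (hlt x h)
        refine ⟨insert x T, ?_, by rw [Finset.card_insert_of_notMem hxT, hTc],
          fun z => if z = x then c else χ z, ?_⟩
        · intro y hy
          rcases Finset.mem_insert.mp hy with rfl | hy
          · exact hx
          · exact Finset.mem_of_mem_erase (hS' (hT hy))
        · intro z hz P hP hzP hPc
          have hPT : P ⊆ T := by
            intro y hy
            rcases Finset.mem_insert.mp (hP hy) with rfl | h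
            · have h1 := hzP y hy
              rcases Finset.mem_insert.mp hz with rfl | h
              · omega
              · have := hlt z h
                omega
            · exact h
          by_cases hzx : z = x
          · subst hzx
            simp only [if_true]
            exact hcol P (hPT.trans hT) hPc
          · simp only [hzx, if_false]
            exact hχ z (Finset.mem_of_mem_insert_of_ne hz hzx) P hPT hzP hPc
    intro m
    obtain ⟨N, hN⟩ := claim (ℓ * m)
    refine ⟨N, fun S hS φ => ?_⟩
    obtain ⟨T, hT, hTc, χ, hχ⟩ := hN S hS φ
    obtain ⟨c, -, hc⟩ := Finset.exists_le_card_fiber_of_mul_le_card_of_maps_to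
      (s := T) (t := (Finset.univ : Finset (Fin ℓ))) (f := χ) (n := m) (fun _ _ => Finset.mem_univ _)
      ⟨⟨0, hℓ⟩, Finset.mem_univ _⟩ (by simp [hTc])
    obtain ⟨M, hM, hMc⟩ := Finset.exists_subset_card_eq hc
    have hMT : M ⊆ T := hM.trans (Finset.filter_subset _ _)
    refine ⟨M, hMT.trans hT, hMc, c, fun P hP hPc => ?_⟩
    have hne : P.Nonempty := Finset.card_pos.mp (by omega)
    obtain ⟨x, hx, hmin⟩ : ∃ x ∈ P, ∀ y ∈ P, x ≤ y :=
      ⟨P.min' hne, P.min'_mem hne, fun y hy => P.min'_le y hy⟩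
    have h := hχ x (hMT (hP hx)) (P.erase x) ((Finset.erase_subset _ _).trans (hP.trans hMT))
      (fun y hy => by
        have h := Finset.mem_erase.mp hy
        have := hmin y h.2
        have := h.1
        omega) (by rw [Finset.card_erase_of_mem hx]; omega)
    rw [Finset.insert_erase hx] at h
    rw [h]
    exact (Finset.mem_filter.mp (hM (hP hx))).2

theorem daisy_nonempty (ℓ r k m : ℕ) (hℓ : 0 < ℓ) :
    {n | ∀ φ : Finset ℕ → Fin ℓ, HasMonoDaisyK n r m k ℓ φ}.Nonempty := by
  obtain ⟨N, hN⟩ := ramsey_aux ℓ hℓ r m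
  refine ⟨k + N, fun φ => ?_⟩
  obtain ⟨M, hM, hMc, c, hc⟩ := hN (Finset.Ico k (k + N)) (by simp)
    (fun P => φ (Finset.range k ∪ P))
  refine ⟨Finset.range k, M, ?_, ?_, ?_, by simp, hMc, c, hc⟩
  · intro x hx
    simp at hx ⊢
    omega
  · intro x hx
    have := hM hx
    simp at this ⊢
    omega
  · rw [Finset.disjoint_left]
    intro x hx hx'
    have := hM hx'
    simp at this hx
    omega

theorem simple_of_daisy (n ℓ r k m : ℕ) (hm : 0 < m) (φ : Finset ℕ → Fin ℓ)
    (h : HasMonoDaisyK n r m k ℓ φ) : HasMonoSimpleDaisyK n r (m ⌈/⌉ (k + 1)) k ℓ φ := by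
  obtain ⟨K, M, hK, hM, hd, hKc, hMc, c, hc⟩ := h
  have hlt : (Finset.range (k + 1)).card * (m ⌈/⌉ (k + 1) - 1) < M.card := by
    rw [Finset.card_range, hMc]
    by_contra hcon
    push Not at hcon
    have h1 : m ⌈/⌉ (k + 1) ≤ m ⌈/⌉ (k + 1) - 1 := by
      rw [ceilDiv_le_iff_le_mul (Nat.succ_pos k)]
      exact hcon
    have h2 : m ⌈/⌉ (k + 1) ≤ 0 := by omega
    rw [ceilDiv_le_iff_le_mul (Nat.succ_pos k)] at h2
    omega
  obtain ⟨j, -, hj⟩ := Finset.exists_lt_card_fiber_of_mul_lt_card_of_maps_to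
    (s := M) (t := Finset.range (k + 1)) (f := fun y => (K.filter (· < y)).card)
    (fun y _ => by
      rw [Finset.mem_range, ← hKc]
      exact Nat.lt_succ_of_le (Finset.card_filter_le _ _)) hlt
  obtain ⟨M', hM', hMc'⟩ := Finset.exists_subset_card_eq
    (show m ⌈/⌉ (k + 1) ≤ _ by exact Nat.le_of_pred_lt hj)
  have hMM : M' ⊆ M := hM'.trans (Finset.filter_subset _ _)
  refine ⟨K, M', hK, hMM.trans hM, Finset.disjoint_of_subset_right hMM hd, hKc, hMc', ?_, c,
    fun P hP => hc P (hP.trans hMM)⟩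
  intro x hx
  by_contra hcon
  push Not at hcon
  obtain ⟨⟨y', hy', h1⟩, ⟨y, hy, h2⟩⟩ := hcon
  have hne : ∀ z ∈ M', x ≠ z := fun z hz he =>
    Finset.disjoint_left.mp hd hx (he ▸ hMM hz)
  have := hne y hy
  have hss : K.filter (· < y') ⊂ K.filter (· < y) := by
    rw [Finset.ssubset_iff_of_subset]
    · exact ⟨x, by simp [hx]; omega, by simp [hx]; omega⟩
    · intro z hz
      simp at hz ⊢
      exact ⟨hz.1, by omega⟩
  have h3 := Finset.card_lt_card hss
  have h4 := (Finset.mem_filter.mp (hM' hy)).2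
  have h5 := (Finset.mem_filter.mp (hM' hy')).2
  omega

/-- For all integers `ℓ ≥ 2`, `r ≥ 2`, `k ≥ 1` and `m > r`,
`D_r(m,k;ℓ) ≥ D_r^smp(⌈m/(k+1)⌉, k; ℓ)`. -/
theorem daisyRamseyK_ge_simple (ℓ r k m : ℕ) (hℓ : 2 ≤ ℓ) (hr : 2 ≤ r)
    (hk : 1 ≤ k) (hm : r < m) :
    simpleDaisyRamseyK r (m ⌈/⌉ (k + 1)) k ℓ ≤ daisyRamseyK r m k ℓ := by
  have h := Nat.sInf_mem (daisy_nonempty ℓ r k m (by omega))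
  exact Nat.sInf_le (fun φ => simple_of_daisy _ ℓ r k m (by omega) φ (h φ))
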